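/- For each τ > 0 let q*_τ be the unique bounded fixed point of the soft Bellman optimality operator B*_τ, and let q*_ref be the unique bounded fixed point of the Bellman reference-optimality operator B̄. Then q*_τ converges to q*_ref monotonically as τ → 0⁺: for each (x,a) ∈ 𝒳 × 𝒜 the map τ ↦ q*_τ(x,a) is nonincreasing in τ, and q*_τ(x,a) increases to q*_ref(x,a) as τ decreases to 0. -/

import Mathlib

open MeasureTheory ProbabilityTheory ENNReal Filter Topology

/-- Bounded measurable real-valued functions. -/
def BoundedMeasurable {Ω : Type*} [MeasurableSpace Ω] (q : Ω → ℝ) : Prop :=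
  Measurable q ∧ ∃ C : ℝ, ∀ p, |q p| ≤ C

/-- The soft value `(V_τ q)(x) = τ log ∫ exp(q(x,a)/τ) dπ̄ₓ(a)`. -/
noncomputable def softV {X A : Type*} [MeasurableSpace X] [MeasurableSpace A]
    (τ : ℝ) (piRef : Kernel X A) (q : X × A → ℝ) (x : X) : ℝ :=
  τ * Real.log (∫ a, Real.exp (q (x, a) / τ) ∂(piRef x))

/-- The soft Bellman optimality operator. -/
noncomputable def softBellmanOpt {X A : Type*} [MeasurableSpace X] [MeasurableSpace A]
    (τ γ : ℝ) (r : X × A → ℝ) (P : Kernel (X × A) X) (piRef : Kernel X A)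
    (q : X × A → ℝ) : X × A → ℝ :=
  fun p => r p + γ * ∫ x', softV τ piRef q x' ∂(P p)

/-- The Bellman reference-optimality operator. -/
noncomputable def refBellmanOpt {X A : Type*} [MeasurableSpace X] [MeasurableSpace A]
    (γ : ℝ) (r : X × A → ℝ) (P : Kernel (X × A) X) (piRef : Kernel X A)
    (q : X × A → ℝ) : X × A → ℝ :=
  fun p => r p + γ * ∫ x', essSup (fun a => q (x', a)) (piRef x') ∂(P p)

section Aux

variable {A : Type*} [MeasurableSpace A]

lemma BoundedMeasurable.integrable {q : A → ℝ} (hq : BoundedMeasurable q) (μ : Measure A)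
    [IsFiniteMeasure μ] : Integrable q μ := by
  obtain ⟨hm, C, hC⟩ := hq
  exact Integrable.of_bound hm.aestronglyMeasurable C (.of_forall hC)

lemma BoundedMeasurable.exp_div {q : A → ℝ} (hq : BoundedMeasurable q) {τ : ℝ} (hτ : 0 < τ) :
    BoundedMeasurable fun a => Real.exp (q a / τ) := by
  obtain ⟨hm, C, hC⟩ := hq
  refine ⟨(hm.div_const τ).exp, Real.exp (C / τ), fun a => ?_⟩
  rw [abs_of_pos (Real.exp_pos _)]
  gcongr
  exact (abs_le.1 (hC a)).2

lemma BoundedMeasurable.curry {X : Type*} [MeasurableSpace X] {q : X × A → ℝ}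
    (hq : BoundedMeasurable q) (x : X) : BoundedMeasurable fun a => q (x, a) :=
  ⟨hq.1.comp measurable_prodMk_left, hq.2.imp fun _ hC a => hC (x, a)⟩

lemma BoundedMeasurable.integral_le_add {u v : A → ℝ} (hu : BoundedMeasurable u)
    (hv : BoundedMeasurable v) (μ : Measure A) [IsProbabilityMeasure μ] {D : ℝ}
    (h : ∀ a, u a ≤ v a + D) : ∫ a, u a ∂μ ≤ ∫ a, v a ∂μ + D := by
  calc ∫ a, u a ∂μ ≤ ∫ a, (v a + D) ∂μ :=
        integral_mono (hu.integrable μ) ((hv.integrable μ).add (integrable_const D)) h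
    _ = _ := by rw [integral_add (hv.integrable μ) (integrable_const D)]; simp

lemma BoundedMeasurable.isBoundedUnder {q : A → ℝ} (hq : BoundedMeasurable q) (μ : Measure A) :
    IsBoundedUnder (· ≤ ·) (ae μ) q :=
  let ⟨C, hC⟩ := hq.2
  isBoundedUnder_of ⟨C, fun a => (abs_le.1 (hC a)).2⟩

lemma BoundedMeasurable.isCoboundedUnder {q : A → ℝ} (hq : BoundedMeasurable q) (μ : Measure A)
    [NeZero μ] : IsCoboundedUnder (· ≤ ·) (ae μ) q :=
  let ⟨C, hC⟩ := hq.2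
  (isBoundedUnder_of (r := (· ≥ ·)) ⟨-C, fun a => (abs_le.1 (hC a)).1⟩).isCoboundedUnder_le

lemma essSup_le_add {u v : A → ℝ} (hu : BoundedMeasurable u)
    (hv : BoundedMeasurable v) (μ : Measure A) [IsProbabilityMeasure μ] {D : ℝ}
    (h : ∀ a, u a ≤ v a + D) : essSup u μ ≤ essSup v μ + D := by
  refine essSup_le_of_ae_le _ ?_ (hu.isCoboundedUnder μ)
  filter_upwards [ae_le_essSup (hv.isBoundedUnder μ)] with a ha
  linarith [h a]

/-- The soft maximum `τ log ∫ exp(f/τ) dμ` of `f` at temperature `τ`. -/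
noncomputable def softMax (τ : ℝ) (μ : Measure A) (f : A → ℝ) : ℝ :=
  τ * Real.log (∫ a, Real.exp (f a / τ) ∂μ)

variable {μ : Measure A} [IsProbabilityMeasure μ] {τ : ℝ} {f g : A → ℝ}

lemma integral_exp_div_pos (hτ : 0 < τ) (hf : BoundedMeasurable f) :
    0 < ∫ a, Real.exp (f a / τ) ∂μ :=
  integral_exp_pos ((hf.exp_div hτ).integrable μ)

lemma softMax_le_add (hτ : 0 < τ) (hf : BoundedMeasurable f) (hg : BoundedMeasurable g) {D : ℝ}
    (h : ∀ᵐ a ∂μ, f a ≤ g a + D) : softMax τ μ f ≤ softMax τ μ g + D := by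
  have key : ∫ a, Real.exp (f a / τ) ∂μ ≤ Real.exp (D / τ) * ∫ a, Real.exp (g a / τ) ∂μ := by
    rw [← integral_const_mul]
    refine integral_mono_ae ((hf.exp_div hτ).integrable μ)
      (((hg.exp_div hτ).integrable μ).const_mul _) ?_
    filter_upwards [h] with a ha
    simp only [← Real.exp_add, ← add_div]
    gcongr
    linarith
  have := Real.log_le_log (integral_exp_div_pos hτ hf) key
  rw [Real.log_mul (Real.exp_ne_zero _) (integral_exp_div_pos hτ hg).ne', Real.log_exp] at this
  calc softMax τ μ f ≤ τ * (D / τ + Real.log (∫ a, Real.exp (g a / τ) ∂μ)) := by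
        unfold softMax; gcongr
    _ = _ := by unfold softMax; field_simp; ring

lemma softMax_const (hτ : 0 < τ) (c : ℝ) : softMax τ μ (fun _ => c) = c := by
  simp [softMax, field]

lemma boundedMeasurable_const (c : ℝ) : BoundedMeasurable fun _ : A => c :=
  ⟨measurable_const, |c|, fun _ => le_rfl⟩

lemma softMax_le (hτ : 0 < τ) (hf : BoundedMeasurable f) {c : ℝ} (h : ∀ᵐ a ∂μ, f a ≤ c) :
    softMax τ μ f ≤ c := by
  have := softMax_le_add (D := 0) hτ hf (boundedMeasurable_const c) (by simpa using h)
  simpa [softMax_const hτ] using this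

lemma le_softMax (hτ : 0 < τ) (hf : BoundedMeasurable f) {c : ℝ} (h : ∀ᵐ a ∂μ, c ≤ f a) :
    c ≤ softMax τ μ f := by
  have := softMax_le_add (D := 0) hτ (boundedMeasurable_const c) hf (by simpa using h)
  simpa [softMax_const hτ] using this

lemma softMax_le_essSup (hτ : 0 < τ) (hf : BoundedMeasurable f) : softMax τ μ f ≤ essSup f μ :=
  softMax_le hτ hf (ae_le_essSup (hf.isBoundedUnder μ))

lemma softMax_antitone {τ' : ℝ} (hτ : 0 < τ) (h : τ ≤ τ') (hf : BoundedMeasurable f) :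
    softMax τ' μ f ≤ softMax τ μ f := by
  have hτ' := hτ.trans_le h
  have hp : 1 ≤ τ' / τ := (one_le_div hτ).2 h
  have hpow (a : A) : Real.exp (f a / τ') ^ (τ' / τ) = Real.exp (f a / τ) := by
    rw [← Real.exp_mul]; congr 1; field_simp
  have jensen := (convexOn_rpow hp).map_integral_le (μ := μ) (f := fun a => Real.exp (f a / τ'))
    (continuousOn_id.rpow_const fun _ _ => .inr (by positivity)) isClosed_Ici
    (.of_forall fun a => (Real.exp_pos _).le) ((hf.exp_div hτ').integrable μ)
    (by simpa only [Function.comp_def, hpow] using (hf.exp_div hτ).integrable μ)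
  simp only [hpow] at jensen
  have hpos := integral_exp_div_pos (μ := μ) hτ' hf
  have := Real.log_le_log (by positivity) jensen
  rw [Real.log_rpow hpos] at this
  calc softMax τ' μ f = τ * (τ' / τ * Real.log (∫ a, Real.exp (f a / τ') ∂μ)) := by
        unfold softMax; field_simp
    _ ≤ _ := by unfold softMax; gcongr

lemma tendsto_softMax_essSup (hf : BoundedMeasurable f) :
    Tendsto (fun τ => softMax τ μ f) (𝓝[>] 0) (𝓝 (essSup f μ)) := by
  refine tendsto_order.2 ⟨fun b hb => ?_, fun b hb => ?_⟩
  · obtain ⟨c, hbc, hc⟩ := exists_between hb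
    set s : Set A := {a | c ≤ f a}
    have hs : MeasurableSet s := measurableSet_le measurable_const hf.1
    have hμs : 0 < μ.real s := by
      by_contra! h0
      refine hc.not_ge (essSup_le_of_ae_le _ ?_ (hf.isCoboundedUnder μ))
      have : ∀ᵐ a ∂μ, a ∉ s :=
        measure_eq_zero_iff_ae_notMem.1
          ((measureReal_eq_zero_iff).1 (h0.antisymm measureReal_nonneg))
      filter_upwards [this] with a ha
      exact (not_le.1 ha).le
    have hlow {τ : ℝ} (hτ : 0 < τ) : τ * Real.log (μ.real s) + c ≤ softMax τ μ f := by
      have h1 : Real.exp (c / τ) * μ.real s ≤ ∫ a, Real.exp (f a / τ) ∂μ :=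
        (setIntegral_ge_of_const_le_real hs (measure_ne_top μ s)
          (fun a (ha : c ≤ f a) => by gcongr)
          ((hf.exp_div hτ).integrable μ).integrableOn).trans
        (setIntegral_le_integral ((hf.exp_div hτ).integrable μ)
          (.of_forall fun a => (Real.exp_pos _).le))
      have h2 := Real.log_le_log (by positivity) h1
      rw [Real.log_mul (Real.exp_ne_zero _) hμs.ne', Real.log_exp] at h2
      calc _ = τ * (c / τ + Real.log (μ.real s)) := by field_simp; ring
        _ ≤ _ := by unfold softMax; gcongr
    have hlim : Tendsto (fun τ : ℝ => τ * Real.log (μ.real s) + c) (𝓝[>] 0) (𝓝 c) := by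
      have : Continuous fun τ : ℝ => τ * Real.log (μ.real s) + c := by fun_prop
      simpa using (this.tendsto 0).mono_left nhdsWithin_le_nhds
    filter_upwards [hlim.eventually_const_lt hbc, self_mem_nhdsWithin] with τ h1 hτ
    exact h1.trans_le (hlow hτ)
  · filter_upwards [self_mem_nhdsWithin] with τ hτ
    exact (softMax_le_essSup hτ hf).trans_lt hb

lemma tendsto_softMax_of_tendsto (hτ : 0 < τ) {F : ℕ → A → ℝ} {C : ℝ} (hF : ∀ n, Measurable (F n))
    (hFC : ∀ n a, |F n a| ≤ C) (hf : BoundedMeasurable f)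
    (h : ∀ a, Tendsto (fun n => F n a) atTop (𝓝 (f a))) :
    Tendsto (fun n => softMax τ μ (F n)) atTop (𝓝 (softMax τ μ f)) := by
  refine Tendsto.const_mul τ (Tendsto.log ?_ (integral_exp_div_pos hτ hf).ne')
  refine tendsto_integral_of_dominated_convergence (fun _ => Real.exp (C / τ))
    (fun n => ((hF n).div_const τ).exp.aestronglyMeasurable) (integrable_const _)
    (fun n => .of_forall fun a => ?_)
    (.of_forall fun a => (Real.continuous_exp.tendsto _).comp ((h a).div_const τ))
  rw [Real.norm_eq_abs, abs_of_pos (Real.exp_pos _)]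
  gcongr
  exact (abs_le.1 (hFC n a)).2

end Aux

section Bellman

variable {X A : Type*} [MeasurableSpace X] [MeasurableSpace A]
  {piRef : Kernel X A} [IsMarkovKernel piRef] {q : X × A → ℝ}

lemma abs_softV_le {τ C : ℝ} (hτ : 0 < τ) (hq : Measurable q) (hC : ∀ p, |q p| ≤ C) (x : X) :
    |softV τ piRef q x| ≤ C := by
  have hqx := BoundedMeasurable.curry ⟨hq, C, hC⟩ x
  exact abs_le.2 ⟨le_softMax hτ hqx (.of_forall fun a => (abs_le.1 (hC (x, a))).1),
    softMax_le hτ hqx (.of_forall fun a => (abs_le.1 (hC (x, a))).2)⟩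

lemma measurable_softV (τ : ℝ) (hq : Measurable q) : Measurable (softV τ piRef q) :=
  ((hq.div_const τ).exp.stronglyMeasurable.integral_kernel_prod_right'
    (κ := piRef)).measurable.log.const_mul τ

lemma BoundedMeasurable.softV {τ : ℝ} (hτ : 0 < τ) (hq : BoundedMeasurable q) :
    BoundedMeasurable (softV τ piRef q) :=
  ⟨measurable_softV τ hq.1, hq.2.imp fun _ hC => abs_softV_le hτ hq.1 hC⟩

lemma tendsto_one_div_add_one_nhdsGT :
    Tendsto (fun n : ℕ => 1 / ((n : ℝ) + 1)) atTop (𝓝[>] 0) :=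
  tendsto_nhdsWithin_iff.2
    ⟨tendsto_one_div_add_atTop_nhds_zero_nat, .of_forall fun n => by simp; positivity⟩

lemma tendsto_softV_essSup (hq : BoundedMeasurable q) (x : X) :
    Tendsto (fun n : ℕ => _root_.softV (1 / ((n : ℝ) + 1)) piRef q x) atTop
      (𝓝 (essSup (fun a => q (x, a)) (piRef x))) :=
  (tendsto_softMax_essSup (hq.curry x)).comp tendsto_one_div_add_one_nhdsGT

lemma BoundedMeasurable.essSup (hq : BoundedMeasurable q) :
    BoundedMeasurable fun x => essSup (fun a => q (x, a)) (piRef x) := by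
  refine ⟨measurable_of_tendsto_metrizable (fun n => measurable_softV _ hq.1)
    (tendsto_pi_nhds.2 (tendsto_softV_essSup hq)), hq.2.imp fun C hC x => ?_⟩
  exact le_of_tendsto (tendsto_softV_essSup hq x).abs
    (.of_forall fun n => abs_softV_le (by positivity) hq.1 hC x)

end Bellman

/-- A difference that is bounded above and whose nonnegative upper bounds contract by `γ` is
nonpositive. -/
lemma le_of_upper_bound_contracts {ι : Type*} {f g : ι → ℝ} {γ B : ℝ} (hγ0 : 0 ≤ γ) (hγ1 : γ < 1)
    (hB : ∀ p, f p ≤ g p + B)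
    (h : ∀ D, (∀ p, f p ≤ g p + D) → ∀ p, f p ≤ g p + γ * D) (p : ι) : f p ≤ g p := by
  have hn (n : ℕ) : ∀ p, f p ≤ g p + γ ^ n * B := by
    induction n with
    | zero => simpa using hB
    | succ n ih => simpa only [pow_succ', mul_assoc] using h _ ih
  have hlim : Tendsto (fun n : ℕ => g p + γ ^ n * B) atTop (𝓝 (g p)) := by
    simpa using ((tendsto_pow_atTop_nhds_zero_of_lt_one hγ0 hγ1).mul_const B).const_add (g p)
  exact ge_of_tendsto' hlim fun n => hn n p

lemma BoundedMeasurable.exists_le_add {Ω : Type*} [MeasurableSpace Ω] {f g : Ω → ℝ}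
    (hf : BoundedMeasurable f) (hg : BoundedMeasurable g) : ∃ B, ∀ p, f p ≤ g p + B := by
  obtain ⟨C, hC⟩ := hf.2
  obtain ⟨C', hC'⟩ := hg.2
  exact ⟨C + C', fun p => by linarith [(abs_le.1 (hC p)).2, (abs_le.1 (hC' p)).1]⟩

/-- The soft optimal action-value functions `q*_τ` converge monotonically, as `τ → 0⁺`, to the
reference-optimal action-value function `q*_ref`: pointwise, `τ ↦ q*_τ(x,a)` is nonincreasing,
`q*_τ(x,a) ≤ q*_ref(x,a)`, and `q*_τ(x,a) → q*_ref(x,a)` as `τ → 0⁺`. -/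
theorem qStar_tendsto_qRef_monotone
    {X A : Type*} [MeasurableSpace X] [MeasurableSpace A]
    [StandardBorelSpace X] [StandardBorelSpace A]
    (P : Kernel (X × A) X) [IsMarkovKernel P]
    (piRef : Kernel X A) [IsMarkovKernel piRef]
    (r : X × A → ℝ) (hr : BoundedMeasurable r)
    (γ : ℝ) (hγ0 : 0 < γ) (hγ1 : γ < 1)
    (qτ : ℝ → X × A → ℝ)
    (hqτ : ∀ τ : ℝ, 0 < τ →
      BoundedMeasurable (qτ τ) ∧ softBellmanOpt τ γ r P piRef (qτ τ) = qτ τ)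
    (qref : X × A → ℝ) (hqref : BoundedMeasurable qref)
    (hqrefFix : refBellmanOpt γ r P piRef qref = qref) :
    ∀ p : X × A,
      (∀ τ₁ τ₂ : ℝ, 0 < τ₁ → τ₁ ≤ τ₂ → qτ τ₂ p ≤ qτ τ₁ p) ∧
      (∀ τ : ℝ, 0 < τ → qτ τ p ≤ qref p) ∧
      Tendsto (fun τ => qτ τ p) (𝓝[>] (0 : ℝ)) (𝓝 (qref p)) := by
  obtain hbm := fun τ hτ => (hqτ τ hτ).1
  have hfix (τ : ℝ) (hτ : 0 < τ) (p : X × A) :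
      qτ τ p = r p + γ * ∫ x, softV τ piRef (qτ τ) x ∂(P p) :=
    (congrFun (hqτ τ hτ).2 p).symm
  have hfixref (p : X × A) :
      qref p = r p + γ * ∫ x, essSup (fun a => qref (x, a)) (piRef x) ∂(P p) :=
    (congrFun hqrefFix p).symm
  have hanti (τ₁ τ₂ : ℝ) (h1 : 0 < τ₁) (h12 : τ₁ ≤ τ₂) (p : X × A) : qτ τ₂ p ≤ qτ τ₁ p := by
    have h2 := h1.trans_le h12
    obtain ⟨B, hB⟩ := (hbm τ₂ h2).exists_le_add (hbm τ₁ h1)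
    refine le_of_upper_bound_contracts hγ0.le hγ1 hB (fun D hD p => ?_) p
    have := ((hbm τ₂ h2).softV (piRef := piRef) h2).integral_le_add
      ((hbm τ₁ h1).softV (piRef := piRef) h1) (P p) (D := D) fun x =>
        (softMax_antitone h1 h12 ((hbm τ₂ h2).curry x)).trans
          (softMax_le_add h1 ((hbm τ₂ h2).curry x) ((hbm τ₁ h1).curry x)
            (.of_forall fun a => hD (x, a)))
    rw [hfix τ₂ h2, hfix τ₁ h1]
    nlinarith
  have hle (τ : ℝ) (hτ : 0 < τ) (p : X × A) : qτ τ p ≤ qref p := by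
    obtain ⟨B, hB⟩ := (hbm τ hτ).exists_le_add hqref
    refine le_of_upper_bound_contracts hγ0.le hγ1 hB (fun D hD p => ?_) p
    have := ((hbm τ hτ).softV (piRef := piRef) hτ).integral_le_add
      (hqref.essSup (piRef := piRef)) (P p) (D := D) fun x =>
        (softMax_le_essSup hτ ((hbm τ hτ).curry x)).trans
          (essSup_le_add ((hbm τ hτ).curry x) (hqref.curry x) _ fun a => hD (x, a))
    rw [hfix τ hτ, hfixref]
    nlinarith
  set t : ℕ → ℝ := fun n => 1 / ((n : ℝ) + 1) with ht
  have htpos (n : ℕ) : 0 < t n := by positivity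
  have htanti : Antitone t := fun m n hmn => by simp only [ht]; gcongr
  set L : X × A → ℝ := fun p => ⨆ n, qτ (t n) p
  have hL (p : X × A) : Tendsto (fun n => qτ (t n) p) atTop (𝓝 (L p)) :=
    tendsto_atTop_ciSup (fun m n hmn => hanti _ _ (htpos n) (htanti hmn) p)
      ⟨qref p, by rintro _ ⟨n, rfl⟩; exact hle _ (htpos n) p⟩
  obtain ⟨C, hC⟩ : ∃ C, ∀ n p, |qτ (t n) p| ≤ C := by
    obtain ⟨C₀, hC₀⟩ := (hbm (t 0) (htpos 0)).2
    obtain ⟨C₁, hC₁⟩ := hqref.2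
    refine ⟨max C₀ C₁, fun n p => abs_le.2 ⟨?_, ?_⟩⟩
    · linarith [hanti _ _ (htpos n) (htanti n.zero_le) p, (abs_le.1 (hC₀ p)).1, le_max_left C₀ C₁]
    · linarith [hle _ (htpos n) p, (abs_le.1 (hC₁ p)).2, le_max_right C₀ C₁]
  have hLbm : BoundedMeasurable L :=
    ⟨measurable_of_tendsto_metrizable (fun n => (hbm _ (htpos n)).1) (tendsto_pi_nhds.2 hL),
      C, fun p => le_of_tendsto' (hL p).abs fun n => hC n p⟩
  have hLm (m : ℕ) (p : X × A) : r p + γ * ∫ x, softV (t m) piRef L x ∂(P p) ≤ L p := by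
    have hlim : Tendsto (fun n => r p + γ * ∫ x, softV (t m) piRef (qτ (t n)) x ∂(P p)) atTop
        (𝓝 (r p + γ * ∫ x, softV (t m) piRef L x ∂(P p))) := by
      refine (Tendsto.const_mul γ ?_).const_add _
      refine tendsto_integral_of_dominated_convergence (fun _ => C)
        (fun n => (measurable_softV _ (hbm _ (htpos n)).1).aestronglyMeasurable)
        (integrable_const _)
        (fun n => .of_forall (abs_softV_le (htpos m) (hbm _ (htpos n)).1 (hC n)))
        (.of_forall fun x => ?_)
      exact tendsto_softMax_of_tendsto (htpos m)
        (fun n => ((hbm _ (htpos n)).curry x).1) (fun n a => hC n (x, a)) (hLbm.curry x)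
        fun a => hL (x, a)
    refine le_of_tendsto_of_tendsto hlim (hL p) ?_
    filter_upwards [eventually_ge_atTop m] with n hmn
    rw [hfix _ (htpos n)]
    gcongr
    · exact ((hbm _ (htpos n)).softV (htpos m)).integrable _
    · exact ((hbm _ (htpos n)).softV (htpos n)).integrable _
    · exact fun x => softMax_antitone (htpos n) (htanti hmn) ((hbm _ (htpos n)).curry x)
  have hLsuper (p : X × A) :
      r p + γ * ∫ x, essSup (fun a => L (x, a)) (piRef x) ∂(P p) ≤ L p := by
    refine le_of_tendsto' (x := atTop) (Tendsto.const_add _ (Tendsto.const_mul γ ?_)) (hLm · p)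
    exact tendsto_integral_of_dominated_convergence (fun _ => C)
      (fun n => (measurable_softV _ hLbm.1).aestronglyMeasurable) (integrable_const _)
      (fun n => .of_forall (abs_softV_le (htpos n) hLbm.1
        fun p => le_of_tendsto' (hL p).abs fun n => hC n p))
      (.of_forall fun x => tendsto_softV_essSup hLbm x)
  have hrefL (p : X × A) : qref p ≤ L p := by
    obtain ⟨B, hB⟩ := hqref.exists_le_add hLbm
    refine le_of_upper_bound_contracts hγ0.le hγ1 hB (fun D hD p => ?_) p
    have := (hqref.essSup (piRef := piRef)).integral_le_add (hLbm.essSup (piRef := piRef)) (P p)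
      (D := D) fun x => essSup_le_add (hqref.curry x) (hLbm.curry x) _ fun a => hD (x, a)
    rw [hfixref]
    nlinarith [hLsuper p]
  refine fun p => ⟨fun τ₁ τ₂ h1 h12 => hanti τ₁ τ₂ h1 h12 p, fun τ hτ => hle τ hτ p,
    tendsto_order.2 ⟨fun b hb => ?_, fun b hb => ?_⟩⟩
  · obtain ⟨n, hn⟩ := ((hL p).eventually_const_lt (hb.trans_le (hrefL p))).exists
    filter_upwards [Ioc_mem_nhdsGT (htpos n)] with τ hτ
    exact hn.trans_le (hanti _ _ hτ.1 hτ.2 p)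
  · filter_upwards [self_mem_nhdsWithin] with τ hτ
    exact (hle τ hτ p).trans_lt hb
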